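/- Let (M_j)_{j∈J} be a finite Kraus family of d_C × d_C complex matrices with ∑_j (M_j)ᴴ M_j = 1 and P_A * M_j * P_B = 0 = P_B * M_j * P_A for all j; let Φ(Θ) = ∑_j M_j Θ (M_j)ᴴ and let Φ̃ be the complementary map. Suppose Φ is degradable: there is a finite family (N_m) of J × d_C matrices with ∑_m (N_m)ᴴ N_m = 1 and Φ̃(ρ) = ∑_m N_m * Φ(ρ) * (N_m)ᴴ for all ρ. Then the A block is degradable: there exists a finite family (L_k) of J × d_C matrices with ∑_k (L_k)ᴴ L_k = P_A and Φ̃(Θ) = ∑_k L_k * Φ(Θ) * (L_k)ᴴ for every Θ with Θ = P_A Θ P_A (and symmetrically for the B block). (Converse direction of Theorem 2: degradability of a PCDS channel implies degradability of each diagonal block; one can take L_k = N_k * P_A.) -/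

import Mathlib

open Matrix

/-- Projector onto the A summand. -/
noncomputable def PA (dA dB : ℕ) : Matrix (Fin dA ⊕ Fin dB) (Fin dA ⊕ Fin dB) ℂ :=
  Matrix.fromBlocks 1 0 0 0

/-- Projector onto the B summand. -/
noncomputable def PB (dA dB : ℕ) : Matrix (Fin dA ⊕ Fin dB) (Fin dA ⊕ Fin dB) ℂ :=
  Matrix.fromBlocks 0 0 0 1

/-- The complementary map associated with a Kraus family. -/
noncomputable def complMap {J n : Type*} [Fintype n] (M : J → Matrix n n ℂ)
    (ρ : Matrix n n ℂ) : Matrix J J ℂ :=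
  Matrix.of fun j j' => ((M j')ᴴ * M j * ρ).trace

theorem PA_add_PB (dA dB : ℕ) : PA dA dB + PB dA dB = 1 := by
  simp [PA, PB, Matrix.fromBlocks_add]

theorem PA_conjTranspose (dA dB : ℕ) : (PA dA dB)ᴴ = PA dA dB := by
  simp [PA, Matrix.fromBlocks_conjTranspose]

theorem PB_conjTranspose (dA dB : ℕ) : (PB dA dB)ᴴ = PB dA dB := by
  simp [PB, Matrix.fromBlocks_conjTranspose]

theorem PA_mul_PA (dA dB : ℕ) : PA dA dB * PA dA dB = PA dA dB := by
  simp [PA, Matrix.fromBlocks_multiply]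

theorem PB_mul_PB (dA dB : ℕ) : PB dA dB * PB dA dB = PB dA dB := by
  simp [PB, Matrix.fromBlocks_multiply]

/-- If two elements add up to one and both off-diagonal corners of `x` vanish, then `x` commutes
with them. -/
theorem mul_comm_of_corners_eq_zero {R : Type*} [Ring R] {p q x : R} (hpq : p + q = 1)
    (hpxq : p * x * q = 0) (hqxp : q * x * p = 0) : p * x = x * p := by
  calc p * x = p * x * (p + q) := by rw [hpq, mul_one]
    _ = (p + q) * x * p := by simp only [mul_add, add_mul, hpxq, hqxp]
    _ = x * p := by rw [hpq, one_mul]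

/-- A degrading family for a channel whose Kraus operators commute with an orthogonal projector
`P` restricts to a degrading family for the corner of `P`. -/
theorem exists_degrading_of_commute {n J K : Type*} [Fintype n] [DecidableEq n] [Fintype J]
    [Fintype K] (P : Matrix n n ℂ) (hP : Pᴴ = P) (hPP : P * P = P) (M : J → Matrix n n ℂ)
    (hcomm : ∀ j, P * M j = M j * P) (N : K → Matrix J n ℂ) (hN1 : ∑ m, (N m)ᴴ * N m = 1)
    (hN2 : ∀ ρ : Matrix n n ℂ,
      complMap M ρ = ∑ m, N m * (∑ j, M j * ρ * (M j)ᴴ) * (N m)ᴴ) :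
    ∃ (m : ℕ) (L : Fin m → Matrix J n ℂ), ∑ k, (L k)ᴴ * L k = P ∧
      ∀ Θ : Matrix n n ℂ, Θ = P * Θ * P →
        complMap M Θ = ∑ k, L k * (∑ j, M j * Θ * (M j)ᴴ) * (L k)ᴴ := by
  let e := (Fintype.equivFin K).symm
  refine ⟨Fintype.card K, fun k => N (e k) * P, ?_, fun Θ hΘ => ?_⟩
  · rw [e.sum_comp fun k => (N k * P)ᴴ * (N k * P)]
    calc ∑ k, (N k * P)ᴴ * (N k * P) = P * (∑ k, (N k)ᴴ * N k) * P := by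
          simp only [Matrix.conjTranspose_mul, hP, Matrix.mul_sum, Matrix.sum_mul,
            Matrix.mul_assoc]
      _ = P := by rw [hN1, Matrix.mul_one, hPP]
  · have hcomm' (j : J) : (M j)ᴴ * P = P * (M j)ᴴ := by
      simpa [Matrix.conjTranspose_mul, hP] using congrArg Matrix.conjTranspose (hcomm j)
    have hout : P * (∑ j, M j * Θ * (M j)ᴴ) * P = ∑ j, M j * Θ * (M j)ᴴ := by
      rw [Matrix.mul_sum, Matrix.sum_mul]
      refine Finset.sum_congr rfl fun j _ => ?_
      calc P * (M j * Θ * (M j)ᴴ) * P = (P * M j) * Θ * ((M j)ᴴ * P) := by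
            simp only [Matrix.mul_assoc]
        _ = M j * (P * Θ * P) * (M j)ᴴ := by
            rw [hcomm, hcomm']; simp only [Matrix.mul_assoc]
        _ = M j * Θ * (M j)ᴴ := by rw [← hΘ]
    rw [e.sum_comp fun k => N k * P * (∑ j, M j * Θ * (M j)ᴴ) * (N k * P)ᴴ, hN2]
    refine Finset.sum_congr rfl fun k _ => ?_
    conv_lhs => rw [← hout]
    simp only [Matrix.conjTranspose_mul, hP, Matrix.mul_assoc]

/-- Converse direction of Theorem 2: degradability of a PCDS channel implies
degradability of each diagonal block (stated here for the A block, and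
symmetrically for the B block). -/
theorem blocks_degradable_of_pcds_degradable {dA dB : ℕ} (hA : 0 < dA) (hB : 0 < dB)
    {J : Type*} [Fintype J]
    (M : J → Matrix (Fin dA ⊕ Fin dB) (Fin dA ⊕ Fin dB) ℂ)
    (htp : ∑ j, (M j)ᴴ * M j = 1)
    (hblock : ∀ j, PA dA dB * M j * PB dA dB = 0 ∧ PB dA dB * M j * PA dA dB = 0)
    {K : Type*} [Fintype K]
    (N : K → Matrix J (Fin dA ⊕ Fin dB) ℂ)
    (hN1 : ∑ m, (N m)ᴴ * N m = 1)
    (hN2 : ∀ ρ : Matrix (Fin dA ⊕ Fin dB) (Fin dA ⊕ Fin dB) ℂ,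
      complMap M ρ = ∑ m, N m * (∑ j, M j * ρ * (M j)ᴴ) * (N m)ᴴ) :
    (∃ (m : ℕ) (L : Fin m → Matrix J (Fin dA ⊕ Fin dB) ℂ),
      ∑ k, (L k)ᴴ * L k = PA dA dB ∧
      ∀ Θ : Matrix (Fin dA ⊕ Fin dB) (Fin dA ⊕ Fin dB) ℂ,
        Θ = PA dA dB * Θ * PA dA dB →
        complMap M Θ = ∑ k, L k * (∑ j, M j * Θ * (M j)ᴴ) * (L k)ᴴ) ∧
    (∃ (m : ℕ) (L : Fin m → Matrix J (Fin dA ⊕ Fin dB) ℂ),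
      ∑ k, (L k)ᴴ * L k = PB dA dB ∧
      ∀ Θ : Matrix (Fin dA ⊕ Fin dB) (Fin dA ⊕ Fin dB) ℂ,
        Θ = PB dA dB * Θ * PB dA dB →
        complMap M Θ = ∑ k, L k * (∑ j, M j * Θ * (M j)ᴴ) * (L k)ᴴ) := by
  exact ⟨exists_degrading_of_commute _ (PA_conjTranspose dA dB) (PA_mul_PA dA dB) M
      (fun j => mul_comm_of_corners_eq_zero (PA_add_PB dA dB) (hblock j).1 (hblock j).2)
      N hN1 hN2,
    exists_degrading_of_commute _ (PB_conjTranspose dA dB) (PB_mul_PB dA dB) M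
      (fun j => mul_comm_of_corners_eq_zero ((add_comm _ _).trans (PA_add_PB dA dB))
        (hblock j).2 (hblock j).1)
      N hN1 hN2⟩
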